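/- A function γ : (0,1) → ℝ has an unbiased estimator based on a Binomial(n, θ) observation — i.e., there exists δ : {0, 1, …, n} → ℝ such that ∑_{k=0}^{n} δ(k) · (n choose k) · θ^k (1−θ)^{n−k} = γ(θ) for all θ ∈ (0,1) — if and only if γ is the restriction to (0,1) of a polynomial of degree at most n. -/

import Mathlib

/-- The Bernstein polynomials of degree `n` sum to one. -/
lemma sum_choose_mul_pow_mul_one_sub_pow (n : ℕ) (θ : ℝ) :
    ∑ k ∈ Finset.range (n + 1), (n.choose k : ℝ) * θ ^ k * (1 - θ) ^ (n - k) = 1 := by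
  have h := add_pow θ (1 - θ) n
  rw [add_sub_cancel, one_pow] at h
  exact (Finset.sum_congr rfl fun k _ => by ring).trans h.symm

/-- Every polynomial of degree at most `n` is a linear combination of the Bernstein
polynomials of degree `n`. -/
lemma exists_sum_bernstein_eq_eval (n : ℕ) (p : Polynomial ℝ) (hp : p.natDegree ≤ n) :
    ∃ δ : ℕ → ℝ, ∀ θ : ℝ, ∑ k ∈ Finset.range (n + 1),
      δ k * (n.choose k : ℝ) * θ ^ k * (1 - θ) ^ (n - k) = p.eval θ := by
  induction n generalizing p with
  | zero =>
    refine ⟨fun _ => p.coeff 0, fun θ => ?_⟩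
    rw [Polynomial.eq_C_of_natDegree_le_zero hp]
    simp
  | succ n ih =>
    obtain ⟨δ, hδ⟩ := ih p.divX (by
      rw [Polynomial.natDegree_divX_eq_natDegree_tsub_one]; omega)
    refine ⟨fun k => p.coeff 0 + k / (n + 1) * δ (k - 1), fun θ => ?_⟩
    have hp_eval : p.eval θ = p.coeff 0 + θ * p.divX.eval θ := by
      conv_lhs => rw [← Polynomial.divX_mul_X_add p]
      simp only [Polynomial.eval_add, Polynomial.eval_mul, Polynomial.eval_X, Polynomial.eval_C]
      ring
    have hshift : ∑ k ∈ Finset.range (n + 1 + 1), (k : ℝ) / (n + 1) * δ (k - 1) *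
        ((n + 1).choose k : ℝ) * θ ^ k * (1 - θ) ^ (n + 1 - k) = θ * p.divX.eval θ := by
      rw [Finset.sum_range_succ', ← hδ θ, Finset.mul_sum]
      simp only [Nat.cast_zero, zero_div, zero_mul, add_zero]
      refine Finset.sum_congr rfl fun k _ => ?_
      have hchoose : ((n : ℝ) + 1) * n.choose k = (n + 1).choose (k + 1) * (k + 1) := by
        exact_mod_cast Nat.add_one_mul_choose_eq n k
      have hn : (n : ℝ) + 1 ≠ 0 := by positivity
      rw [Nat.add_sub_add_right n, Nat.add_sub_cancel]
      push_cast
      field_simp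
      linear_combination -δ k * θ ^ (k + 1) * (1 - θ) ^ (n - k) * hchoose
    have hconst := congrArg (p.coeff 0 * ·) (sum_choose_mul_pow_mul_one_sub_pow (n + 1) θ)
    simp only [mul_one, Finset.mul_sum] at hconst
    rw [hp_eval, ← hshift]
    refine Eq.trans ?_ (congrArg (· + _) hconst)
    rw [← Finset.sum_add_distrib]
    exact Finset.sum_congr rfl fun k _ => by ring

/-- **Unbiasedly estimable functions in the binomial model.**
A function `γ : (0,1) → ℝ` has an unbiased estimator based on a `Binomial(n, θ)`
observation iff it is the restriction to `(0,1)` of a polynomial of degree at most `n`. -/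
theorem binomial_unbiased_iff_polynomial (n : ℕ) (γ : ℝ → ℝ) :
    (∃ δ : ℕ → ℝ, ∀ θ ∈ Set.Ioo (0 : ℝ) 1,
        ∑ k ∈ Finset.range (n + 1),
          δ k * (n.choose k : ℝ) * θ ^ k * (1 - θ) ^ (n - k) = γ θ) ↔
    (∃ p : Polynomial ℝ, p.degree ≤ n ∧ ∀ θ ∈ Set.Ioo (0 : ℝ) 1, γ θ = p.eval θ) := by
  constructor
  · rintro ⟨δ, hδ⟩
    refine ⟨∑ k ∈ Finset.range (n + 1), Polynomial.C (δ k) * bernsteinPolynomial ℝ n k, ?_, ?_⟩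
    · rw [← Polynomial.natDegree_le_iff_degree_le]
      refine Polynomial.natDegree_sum_le_of_forall_le _ _ fun k hk => ?_
      have hkn : k + (n - k) = n := by have := Finset.mem_range.mp hk; omega
      unfold bernsteinPolynomial
      compute_degree
      omega
    · intro θ hθ
      rw [← hδ θ hθ, Polynomial.eval_finsetSum]
      refine Finset.sum_congr rfl fun k _ => ?_
      simp [bernsteinPolynomial]
      ring
  · rintro ⟨p, hp, hγ⟩
    obtain ⟨δ, hδ⟩ := exists_sum_bernstein_eq_eval n p (Polynomial.natDegree_le_of_degree_le hp)
    exact ⟨δ, fun θ hθ => (hδ θ).trans (hγ θ hθ).symm⟩
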